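/- arXiv:math/0506199 — 9 statements merged into one kernel-verified Lean document; each statement's English description precedes it below -/
import Mathlib

section
/- (The δ Lemma) For every polynomial p of degree at most n+1, and every i ∈ {1,…,n+1}, one has ⟨p|u_i⟩ = ⟨1|u_i⟩ · p(x_i); that is, up to the factor ⟨1|u_i⟩, the projection of p onto u_i is obtained by evaluating p at x_i. -/
open Polynomial MeasureTheory

/-- Polynomials of degree at most `n` that are orthonormal with respect to `L (f * g)` and indexed by
`Fin (n + 1)` span the space of all polynomials of degree at most `n`. -/
theorem span_eq_degreeLT_of_orthonormal {n : ℕ} (L : ℝ[X] →ₗ[ℝ] ℝ) {u : Fin (n + 1) → ℝ[X]}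
    (hu : ∀ i, (u i).natDegree ≤ n) (horth : ∀ i j, L (u i * u j) = if i = j then 1 else 0) :
    Submodule.span ℝ (Set.range u) = degreeLT ℝ (n + 1) := by
  have hli : LinearIndependent ℝ u := by
    rw [Fintype.linearIndependent_iff]
    intro c hc i
    have h := congrArg (fun q => L (u i * q)) hc
    simpa [Finset.mul_sum, horth] using h
  have hfin : Module.Finite ℝ (degreeLT ℝ (n + 1)) :=
    Module.Finite.equiv (degreeLTEquiv ℝ (n + 1)).symm
  refine Submodule.eq_of_le_of_finrank_eq ?_ ?_
  · rw [Submodule.span_le]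
    rintro _ ⟨i, rfl⟩
    rw [SetLike.mem_coe, mem_degreeLT]
    exact degree_le_natDegree.trans_lt (by exact_mod_cast Nat.lt_succ_of_le (hu i))
  · rw [finrank_span_eq_card hli, (degreeLTEquiv ℝ (n + 1)).finrank_eq]
    simp

/-- The δ lemma for an arbitrary linear functional on polynomials. -/
theorem apply_mul_eq_apply_mul_eval {n : ℕ} (L : ℝ[X] →ₗ[ℝ] ℝ) {u : Fin (n + 1) → ℝ[X]}
    {x : Fin (n + 1) → ℝ} (hu : ∀ i, (u i).natDegree ≤ n)
    (horth : ∀ i j, L (u i * u j) = if i = j then 1 else 0)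
    (heig : ∀ i j, L (X * u i * u j) = if i = j then x i else 0)
    {p : ℝ[X]} (hp : p.natDegree ≤ n + 1) (i : Fin (n + 1)) :
    L (p * u i) = L (u i) * p.eval (x i) := by
  have hker : ∀ q ∈ degreeLT ℝ (n + 1), L ((X - C (x i)) * u i * q) = 0 := by
    intro q hq
    rw [← span_eq_degreeLT_of_orthonormal L hu horth] at hq
    induction hq using Submodule.span_induction with
    | mem q hq =>
      obtain ⟨j, rfl⟩ := hq
      rw [sub_mul, sub_mul, map_sub, heig, mul_assoc, ← smul_eq_C_mul, map_smul, horth]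
      split_ifs <;> simp
    | zero => simp
    | add q r _ _ hq hr => rw [mul_add, map_add, hq, hr, add_zero]
    | smul c q _ hq => rw [mul_smul_comm, map_smul, hq, smul_zero]
  have hdiv : p /ₘ (X - C (x i)) ∈ degreeLT ℝ (n + 1) := by
    rw [mem_degreeLT]
    refine degree_le_natDegree.trans_lt ?_
    rw [natDegree_divByMonic p (monic_X_sub_C _), natDegree_X_sub_C]
    exact_mod_cast (by omega : p.natDegree - 1 < n + 1)
  have hdecomp : p * u i
      = p.eval (x i) • u i + (X - C (x i)) * u i * (p /ₘ (X - C (x i))) := by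
    conv_lhs => rw [← modByMonic_add_div p (X - C (x i)), modByMonic_X_sub_C_eq_C_eval]
    rw [smul_eq_C_mul]
    ring
  rw [hdecomp, map_add, hker _ hdiv, add_zero, map_smul, smul_eq_mul, mul_comm]

/-- Integration over `[a, b]` against a continuous weight, as a linear functional on polynomials. -/
noncomputable def weightedIntegral (a b : ℝ) (w : ℝ → ℝ) (hw : ContinuousOn w (Set.uIcc a b)) :
    ℝ[X] →ₗ[ℝ] ℝ where
  toFun q := ∫ t in a..b, w t * q.eval t
  map_add' q r := by
    have hintegrable (s : ℝ[X]) : IntervalIntegrable (fun t => w t * s.eval t) volume a b :=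
      (hw.mul s.continuous.continuousOn).intervalIntegrable
    simp only [eval_add, mul_add]
    exact intervalIntegral.integral_add (hintegrable q) (hintegrable r)
  map_smul' c q := by
    simp only [eval_smul, smul_eq_mul, RingHom.id_apply, mul_left_comm _ c]
    exact intervalIntegral.integral_const_mul _ _

/-- **The δ Lemma.** For every polynomial `p` of degree at most `n+1` and every
`i ∈ {1,…,n+1}`, one has `⟨p|u_i⟩ = ⟨1|u_i⟩ · p(x_i)`. -/
theorem delta_lemma
    (n : ℕ) (a b : ℝ) (hab : a < b)
    (w : ℝ → ℝ) (hw_cont : ContinuousOn w (Set.Icc a b))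
    (hw_pos : ∀ t ∈ Set.Ioo a b, 0 < w t)
    (u : Fin (n + 1) → Polynomial ℝ) (hu_deg : ∀ i, (u i).natDegree ≤ n)
    (x : Fin (n + 1) → ℝ)
    (horth : ∀ i j, (∫ t in a..b, w t * (u i).eval t * (u j).eval t)
      = if i = j then 1 else 0)
    (heig : ∀ i j, (∫ t in a..b, w t * t * (u i).eval t * (u j).eval t)
      = if i = j then x i else 0)
    (p : Polynomial ℝ) (hp : p.natDegree ≤ n + 1) (i : Fin (n + 1)) :
    (∫ t in a..b, w t * p.eval t * (u i).eval t)
      = (∫ t in a..b, w t * (u i).eval t) * p.eval (x i) := by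
  have hw : ContinuousOn w (Set.uIcc a b) := by rwa [Set.uIcc_of_le hab.le]
  have h := apply_mul_eq_apply_mul_eval (weightedIntegral a b w hw) (x := x) hu_deg
    (by simpa [weightedIntegral, mul_assoc] using horth)
    (by simpa [weightedIntegral, mul_assoc] using heig) hp i
  simpa [weightedIntegral, mul_assoc] using h
end

section
/- (Theorem 2, part 2) Each node lies in the interval of integration: a ≤ x_i ≤ b for all i ∈ {1,…,n+1}. -/
open Polynomial MeasureTheory

/-- **Theorem 2, part 2.** Each node lies in the interval of integration:
`a ≤ x_i ≤ b`. -/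
theorem nodes_in_interval
(n : ℕ) (a b : ℝ) (hab : a < b)
    (w : ℝ → ℝ) (hw_cont : ContinuousOn w (Set.Icc a b))
    (hw_pos : ∀ t ∈ Set.Ioo a b, 0 < w t)
    (u : Fin (n + 1) → Polynomial ℝ) (hu_deg : ∀ i, (u i).natDegree ≤ n)
    (x : Fin (n + 1) → ℝ)
    (horth : ∀ i j, (∫ t in a..b, w t * (u i).eval t * (u j).eval t)
      = if i = j then 1 else 0)
    (heig : ∀ i j, (∫ t in a..b, w t * t * (u i).eval t * (u j).eval t)
      = if i = j then x i else 0)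
    (i : Fin (n + 1)) :
    x i ∈ Set.Icc a b := by
  have horth_self : ∫ t in a..b, w t * (u i).eval t * (u i).eval t = 1 := by
    simpa using horth i i
  have heig_self : ∫ t in a..b, w t * t * (u i).eval t * (u i).eval t = x i := by
    simpa using heig i i
  have hint : IntervalIntegrable (fun t => w t * (u i).eval t * (u i).eval t) volume a b :=
    ContinuousOn.intervalIntegrable_of_Icc hab.le (by fun_prop)
  have hintX : IntervalIntegrable (fun t => w t * t * (u i).eval t * (u i).eval t) volume a b :=
    ContinuousOn.intervalIntegrable_of_Icc hab.le (by fun_prop)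
  have hnonneg : ∀ t ∈ Set.Ioo a b, 0 ≤ w t * (u i).eval t * (u i).eval t := fun t ht => by
    rw [mul_assoc]
    exact mul_nonneg (hw_pos t ht).le (mul_self_nonneg _)
  constructor
  · calc a = ∫ t in a..b, a * (w t * (u i).eval t * (u i).eval t) := by
          rw [intervalIntegral.integral_const_mul, horth_self, mul_one]
      _ ≤ ∫ t in a..b, w t * t * (u i).eval t * (u i).eval t :=
          intervalIntegral.integral_mono_on_of_le_Ioo hab.le (hint.const_mul a) hintX
            fun t ht => by linarith [mul_le_mul_of_nonneg_right ht.1.le (hnonneg t ht)]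
      _ = x i := heig_self
  · calc x i = ∫ t in a..b, w t * t * (u i).eval t * (u i).eval t := heig_self.symm
      _ ≤ ∫ t in a..b, b * (w t * (u i).eval t * (u i).eval t) :=
          intervalIntegral.integral_mono_on_of_le_Ioo hab.le hintX (hint.const_mul b)
            fun t ht => by linarith [mul_le_mul_of_nonneg_right ht.2.le (hnonneg t ht)]
      _ = b := by rw [intervalIntegral.integral_const_mul, horth_self, mul_one]
end

section
/- (Theorem 2, part 1: uniqueness) Suppose X_1,…,X_{n+1} are distinct real numbers and W_1,…,W_{n+1} are strictly positive real numbers such that ∫_a^b w(x) p(x) dx = Σ_{i=1}^{n+1} W_i p(X_i) for every polynomial p of degree at most 2n+1. Then there is a permutation σ of {1,…,n+1} such that X_i = x_{σ(i)} and W_i = ⟨1|u_{σ(i)}⟩² for all i. That is, the Gaussian quadrature formula is unique up to ordering of the nodes. -/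
open Polynomial MeasureTheory

/-- If the rows of `A` are orthonormal for the weights `W` and diagonalize multiplication by `X`,
then a nonzero entry of `A` identifies a node with an eigenvalue, and no column of `A` vanishes. -/
theorem Matrix.eq_of_entry_ne_zero_of_weighted_orthonormal {ι : Type*} [Fintype ι] [DecidableEq ι]
    (A : Matrix ι ι ℝ) (W X x : ι → ℝ)
    (horth : ∀ i j, ∑ k, W k * (A i k * A j k) = if i = j then 1 else 0)
    (heig : ∀ i j, ∑ k, W k * (X k * (A i k * A j k)) = if i = j then x i else 0) :
    (∀ i k, A i k ≠ 0 → X k = x i) ∧ ∀ k, ∃ i, A i k ≠ 0 := by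
  have hAB : A * (Matrix.diagonal W * A.transpose) = 1 := by
    ext i j
    rw [Matrix.mul_apply, Matrix.one_apply, ← horth i j]
    refine Finset.sum_congr rfl fun k _ => ?_
    rw [Matrix.diagonal_mul, Matrix.transpose_apply]
    ring
  have hBA := mul_eq_one_comm.mp hAB
  have hADB : A * Matrix.diagonal X * (Matrix.diagonal W * A.transpose) = Matrix.diagonal x := by
    ext i j
    rw [Matrix.mul_apply, Matrix.diagonal_apply, ← heig i j]
    refine Finset.sum_congr rfl fun k _ => ?_
    rw [Matrix.mul_diagonal, Matrix.diagonal_mul, Matrix.transpose_apply]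
    ring
  have hAD : A * Matrix.diagonal X = Matrix.diagonal x * A := by
    rw [← hADB, Matrix.mul_assoc _ _ A, hBA, Matrix.mul_one]
  refine ⟨fun i k hik => ?_, fun k => ?_⟩
  · have h := congrFun (congrFun hAD i) k
    rw [Matrix.mul_diagonal, Matrix.diagonal_mul, mul_comm] at h
    exact mul_right_cancel₀ hik h
  · by_contra! h
    have hkk := congrFun (congrFun hBA k) k
    simp [Matrix.mul_apply, h] at hkk

/-- **Theorem 2, part 1 (uniqueness).** Any quadrature rule with distinct nodes
and positive weights that is exact on polynomials of degree at most `2n+1`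
coincides, up to reordering, with the Gaussian rule with nodes `x_i` and
weights `⟨1|u_i⟩²`. -/
theorem gaussian_quadrature_unique
(n : ℕ) (a b : ℝ) (hab : a < b)
    (w : ℝ → ℝ) (hw_cont : ContinuousOn w (Set.Icc a b))
    (hw_pos : ∀ t ∈ Set.Ioo a b, 0 < w t)
    (u : Fin (n + 1) → Polynomial ℝ) (hu_deg : ∀ i, (u i).natDegree ≤ n)
    (x : Fin (n + 1) → ℝ)
    (horth : ∀ i j, (∫ t in a..b, w t * (u i).eval t * (u j).eval t)
      = if i = j then 1 else 0)
    (heig : ∀ i j, (∫ t in a..b, w t * t * (u i).eval t * (u j).eval t)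
      = if i = j then x i else 0)
    (X W : Fin (n + 1) → ℝ)
    (hX : Function.Injective X)
    (hW : ∀ i, 0 < W i)
    (hquad : ∀ p : Polynomial ℝ, p.natDegree ≤ 2 * n + 1 →
      (∫ t in a..b, w t * p.eval t) = ∑ i, W i * p.eval (X i)) :
    ∃ σ : Equiv.Perm (Fin (n + 1)), ∀ i,
      X i = x (σ i) ∧ W i = (∫ t in a..b, w t * (u (σ i)).eval t) ^ 2 := by
  have hdeg (i j) : (u i * u j).natDegree ≤ 2 * n := by
    have := natDegree_mul_le (p := u i) (q := u j)
    have := hu_deg i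
    have := hu_deg j
    omega
  have horth_sum (i j) : ∑ k, W k * ((u i).eval (X k) * (u j).eval (X k))
      = if i = j then 1 else 0 := by
    have h := hquad _ ((hdeg i j).trans (Nat.le_succ _))
    simp only [eval_mul] at h
    rw [← h, ← horth i j]
    simp only [mul_assoc]
  have heig_sum (i j) : ∑ k, W k * (X k * ((u i).eval (X k) * (u j).eval (X k)))
      = if i = j then x i else 0 := by
    have hd : (Polynomial.X * (u i * u j)).natDegree ≤ 2 * n + 1 := by
      have := natDegree_mul_le (p := Polynomial.X) (q := u i * u j)
      have := hdeg i j
      have := natDegree_X_le (R := ℝ)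
      omega
    have h := hquad _ hd
    simp only [eval_mul, eval_X] at h
    rw [← h, ← heig i j]
    simp only [mul_assoc]
  obtain ⟨hnode, hcol⟩ := Matrix.eq_of_entry_ne_zero_of_weighted_orthonormal
    (fun i k => (u i).eval (X k)) W X x horth_sum heig_sum
  choose σ hσ using hcol
  have hXσ (k) : X k = x (σ k) := hnode _ _ (hσ k)
  have hσ_inj : Function.Injective σ := fun k l hkl => hX (by rw [hXσ k, hXσ l, hkl])
  have hzero (k j) (hjk : j ≠ k) : (u (σ k)).eval (X j) = 0 := by
    by_contra h
    exact hjk (hX ((hnode _ _ h).trans (hXσ k).symm))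
  refine ⟨Equiv.ofBijective σ (Finite.injective_iff_bijective.mp hσ_inj), fun k => ⟨hXσ k, ?_⟩⟩
  rw [Equiv.ofBijective_apply, hquad _ ((hu_deg _).trans (by omega)),
    Fintype.sum_eq_single k fun j hj => by rw [hzero k j hj, mul_zero]]
  have hnorm := horth_sum (σ k) (σ k)
  rw [if_pos rfl, Fintype.sum_eq_single k fun j hj => by simp [hzero k j hj]] at hnorm
  linear_combination -(W k) * hnorm
end

section
/- Suppose X_1,…,X_{n+1} are distinct real numbers and W_1,…,W_{n+1} are strictly positive real numbers such that ∫_a^b w(x) p(x) dx = Σ_{i=1}^{n+1} W_i p(X_i) for every polynomial p of degree at most 2n+1. Let U_1,…,U_{n+1} be the unique polynomials of degree at most n satisfying U_j(X_i) = δ_ij / √(W_i). Then ⟨U_i|U_j⟩ = δ_ij, X(U_i,U_j) = X_i δ_ij, and ⟨1|U_i⟩ = √(W_i) for all i, j ∈ {1,…,n+1}; i.e., the cardinal-type polynomials U_i are orthonormal eigenvectors of the bilinear form X with eigenvalues X_i. -/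
open Polynomial MeasureTheory

/-- The cardinal-type polynomials `U_i` determined by `U_j(X_i) = δ_ij/√W_i`
are orthonormal eigenvectors of the bilinear form `X(·,·)` with eigenvalues
`X_i`, and `⟨1|U_i⟩ = √W_i`. -/
theorem cardinal_polynomials_orthonormal_eigenvectors
    (n : ℕ) (a b : ℝ) (hab : a < b)
    (w : ℝ → ℝ) (hw_cont : ContinuousOn w (Set.Icc a b))
    (hw_pos : ∀ t ∈ Set.Ioo a b, 0 < w t)
    (X W : Fin (n + 1) → ℝ)
    (hX : Function.Injective X)
    (hW : ∀ i, 0 < W i)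
    (hquad : ∀ p : Polynomial ℝ, p.natDegree ≤ 2 * n + 1 →
      (∫ t in a..b, w t * p.eval t) = ∑ i, W i * p.eval (X i))
    (U : Fin (n + 1) → Polynomial ℝ)
    (hU_deg : ∀ j, (U j).natDegree ≤ n)
    (hU_val : ∀ i j, (U j).eval (X i)
      = (if i = j then 1 else 0) / Real.sqrt (W i)) :
    (∀ i j, (∫ t in a..b, w t * (U i).eval t * (U j).eval t)
        = if i = j then 1 else 0) ∧
    (∀ i j, (∫ t in a..b, w t * t * (U i).eval t * (U j).eval t)
        = if i = j then X i else 0) ∧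
    (∀ i, (∫ t in a..b, w t * (U i).eval t) = Real.sqrt (W i)) := by
  have hsqrt : ∀ i, Real.sqrt (W i) ≠ 0 := fun i => (Real.sqrt_pos.mpr (hW i)).ne'
  have hsum : ∀ (q : Polynomial ℝ) i, q.natDegree ≤ n + 1 →
      (∫ t in a..b, w t * (q * U i).eval t) = Real.sqrt (W i) * q.eval (X i) := by
    intro q i hq
    have hdeg : (q * U i).natDegree ≤ 2 * n + 1 :=
      natDegree_mul_le.trans (by have := hU_deg i; omega)
    rw [hquad _ hdeg, Finset.sum_eq_single i]
    · rw [eval_mul, hU_val, if_pos rfl]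
      have := hsqrt i
      nth_rewrite 1 [← Real.mul_self_sqrt (hW i).le]
      field_simp
    · intro k _ hk
      simp [hU_val, hk]
    · simp
  refine ⟨fun i j => ?_, fun i j => ?_, fun i => ?_⟩
  · have h := hsum (U i) j ((hU_deg i).trans n.le_succ)
    simp only [eval_mul, ← mul_assoc] at h
    rw [h, hU_val]
    rcases eq_or_ne i j with rfl | hij
    · simp [hsqrt i]
    · simp [hij, hij.symm]
  · have hdeg : (Polynomial.X * U i).natDegree ≤ n + 1 :=
      natDegree_mul_le.trans (by have := hU_deg i; rw [natDegree_X]; omega)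
    have h := hsum (Polynomial.X * U i) j hdeg
    simp only [eval_mul, eval_X, ← mul_assoc] at h
    rw [h, hU_val]
    rcases eq_or_ne i j with rfl | hij
    · have := hsqrt i
      simp only [if_true]
      field_simp
    · simp [hij, hij.symm]
  · simpa using hsum 1 i (by simp)
end

section
/- (Theorem 3) Suppose x_1,…,x_{n+1} are distinct real numbers and w_1,…,w_{n+1} are strictly positive real numbers such that ∫_a^b w(x) p(x) dx = Σ_{k=1}^{n+1} w_k p(x_k) for every polynomial p of degree at most 2n+1. Let q_1,…,q_{n+1} be any basis of P_n and define B_{ij} = ∫_a^b w(x) q_i(x) q_j(x) dx and A_{ij} = ∫_a^b w(x) x q_i(x) q_j(x) dx. Suppose the (n+1)×(n+1) real matrices V and D satisfy Vᵀ B V = I and A V = B V D with D diagonal. Then, after a suitable reordering of the indexing of the pairs (x_i, w_i) (i.e., there is a permutation matching nodes to diagonal entries), x_i = D_{ii} for all i, and w_i · q_j(x_i)² = ((V^{-1})_{ij})² for all i and all j. -/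
open Polynomial MeasureTheory Matrix

/-- An orthogonal matrix that intertwines a diagonal matrix with distinct entries and another
diagonal matrix is a signed permutation matrix. -/
lemma exists_perm_of_orthogonal_of_diagonal_mul_eq {ι : Type*} [Fintype ι] [DecidableEq ι]
    {x : ι → ℝ} (hx : Function.Injective x) {U D : Matrix ι ι ℝ} (hU : Uᵀ * U = 1)
    (hD : D.IsDiag) (hXU : diagonal x * U = U * D) :
    ∃ σ : Equiv.Perm ι, ∀ i, x (σ i) = D i i ∧ U (σ i) i ^ 2 = 1 ∧
      ∀ k, k ≠ σ i → U k i = 0 := by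
  have entry : ∀ k i, U k i ≠ 0 → x k = D i i := by
    intro k i hki
    have h := congrFun (congrFun hXU k) i
    rw [← hD.diagonal_diag, diagonal_mul, mul_diagonal, mul_comm] at h
    exact mul_left_cancel₀ hki h
  have orth : ∀ i j, ∑ k, U k i * U k j = (1 : Matrix ι ι ℝ) i j := by
    intro i j
    rw [← hU, mul_apply]
    rfl
  have col : ∀ i, ∃ k, U k i ≠ 0 := by
    intro i
    by_contra! h
    simpa [h] using orth i i
  choose f hf using col
  have zero : ∀ i k, k ≠ f i → U k i = 0 := by
    intro i k hk
    by_contra h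
    exact hk (hx ((entry k i h).trans (entry _ i (hf i)).symm))
  have single : ∀ i j, U (f i) i * U (f i) j = (1 : Matrix ι ι ℝ) i j := by
    intro i j
    rw [← orth i j]
    symm
    refine Finset.sum_eq_single (f i) (fun k _ hk => ?_) (by simp)
    rw [zero i k hk, zero_mul]
  have inj : Function.Injective f := by
    intro i j hij
    by_contra hne
    have h := single i j
    rw [one_apply_ne hne] at h
    exact mul_ne_zero (hf i) (hij ▸ hf j) h
  refine ⟨Equiv.ofBijective f (Finite.injective_iff_bijective.mp inj), fun i =>
    ⟨entry _ i (hf i), ?_, zero i⟩⟩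
  simpa [sq] using single i i

/-- **Theorem 3.** If `Vᵀ B V = I` and `A V = B V D` with `D` diagonal, then
(after a suitable reordering of the pairs `(x_i, w_i)`) the nodes are the
diagonal entries of `D` and the weights satisfy
`w_i · q_j(x_i)² = ((V⁻¹)_{ij})²` for every `j`. -/
theorem nodes_and_weights_from_generalized_eigenproblem
    (n : ℕ) (a b : ℝ) (hab : a < b)
    (w : ℝ → ℝ) (hw_cont : ContinuousOn w (Set.Icc a b))
    (hw_pos : ∀ t ∈ Set.Ioo a b, 0 < w t)
    (x wts : Fin (n + 1) → ℝ)
    (hx : Function.Injective x)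
    (hwts : ∀ k, 0 < wts k)
    (hquad : ∀ p : Polynomial ℝ, p.natDegree ≤ 2 * n + 1 →
      (∫ t in a..b, w t * p.eval t) = ∑ k, wts k * p.eval (x k))
    (q : Fin (n + 1) → Polynomial ℝ)
    (hq_deg : ∀ i, (q i).natDegree ≤ n)
    (hq_indep : LinearIndependent ℝ q)
    (B A V D : Matrix (Fin (n + 1)) (Fin (n + 1)) ℝ)
    (hB : ∀ i j, B i j = ∫ t in a..b, w t * (q i).eval t * (q j).eval t)
    (hA : ∀ i j, A i j = ∫ t in a..b, w t * t * (q i).eval t * (q j).eval t)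
    (hD : D.IsDiag)
    (hVBV : Vᵀ * B * V = 1)
    (hAV : A * V = B * V * D) :
    ∃ σ : Equiv.Perm (Fin (n + 1)), ∀ i,
      x (σ i) = D i i ∧
      ∀ j, wts (σ i) * ((q j).eval (x (σ i))) ^ 2 = (V⁻¹ i j) ^ 2 := by
  set M : Matrix (Fin (n + 1)) (Fin (n + 1)) ℝ :=
    of fun k j => √(wts k) * (q j).eval (x k) with hM
  have sqrt_mul : ∀ k, √(wts k) * √(wts k) = wts k := fun k => Real.mul_self_sqrt (hwts k).le
  have B_eq : B = Mᵀ * M := by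
    ext i j
    have hdeg : (q i * q j).natDegree ≤ 2 * n + 1 := by
      have := natDegree_mul_le (p := q i) (q := q j)
      have := hq_deg i
      have := hq_deg j
      lia
    have h := hquad _ hdeg
    simp only [eval_mul, ← mul_assoc] at h
    rw [hB, h, mul_apply]
    refine Finset.sum_congr rfl fun k _ => ?_
    simp only [hM, transpose_apply, of_apply]
    linear_combination -((q i).eval (x k) * (q j).eval (x k)) * sqrt_mul k
  have A_eq : A = Mᵀ * (diagonal x * M) := by
    ext i j
    have hdeg : (X * q i * q j).natDegree ≤ 2 * n + 1 := by
      have := natDegree_mul_le (p := X * q i) (q := q j)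
      have := natDegree_mul_le (p := X) (q := q i)
      have := natDegree_X_le (R := ℝ)
      have := hq_deg i
      have := hq_deg j
      lia
    have h := hquad _ hdeg
    simp only [eval_mul, eval_X, ← mul_assoc] at h
    rw [hA, h, mul_apply]
    refine Finset.sum_congr rfl fun k _ => ?_
    simp only [hM, transpose_apply, diagonal_mul, of_apply]
    linear_combination -(x k * (q i).eval (x k) * (q j).eval (x k)) * sqrt_mul k
  have V_inv : V⁻¹ = (M * V)ᵀ * M := by
    rw [inv_eq_left_inv hVBV, B_eq, transpose_mul, Matrix.mul_assoc]
  have U_orth : (M * V)ᵀ * (M * V) = 1 := by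
    rw [← hVBV, B_eq, transpose_mul]
    simp only [Matrix.mul_assoc]
  have U_diag : (M * V)ᵀ * (diagonal x * (M * V)) = D := by
    calc (M * V)ᵀ * (diagonal x * (M * V)) = Vᵀ * (A * V) := by
          rw [A_eq, transpose_mul]
          simp only [Matrix.mul_assoc]
      _ = Vᵀ * B * V * D := by
          rw [hAV]
          simp only [Matrix.mul_assoc]
      _ = D := by rw [hVBV, Matrix.one_mul]
  have XU : diagonal x * (M * V) = M * V * D := by
    rw [← U_diag, ← Matrix.mul_assoc (M * V), mul_eq_one_comm.mp U_orth, Matrix.one_mul]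
  obtain ⟨σ, hσ⟩ := exists_perm_of_orthogonal_of_diagonal_mul_eq hx U_orth hD XU
  refine ⟨σ, fun i => ⟨(hσ i).1, fun j => ?_⟩⟩
  obtain ⟨-, hsq, hzero⟩ := hσ i
  have entry : V⁻¹ i j = (M * V) (σ i) i * M (σ i) j := by
    rw [V_inv, mul_apply]
    refine Finset.sum_eq_single (σ i) (fun k _ hk => ?_) (by simp)
    rw [transpose_apply, hzero k hk, zero_mul]
  rw [entry, mul_pow, hsq, one_mul, hM, of_apply, mul_pow, Real.sq_sqrt (hwts _).le]
end

section
/- Suppose x_1,…,x_{n+1} are distinct real numbers and w_1,…,w_{n+1} are strictly positive real numbers such that ∫_a^b w(x) p(x) dx = Σ_{k=1}^{n+1} w_k p(x_k) for every polynomial p of degree at most 2n+1. Let q_1,…,q_{n+1} be a basis of P_n, define B_{ij} = ∫_a^b w(x) q_i(x) q_j(x) dx and A_{ij} = ∫_a^b w(x) x q_i(x) q_j(x) dx, and let Q_{ik} = q_i(x_k). Suppose V and D satisfy Vᵀ B V = I and A V = B V D with D diagonal, and suppose the ordering is such that D_{ii} = x_i for all i. Let W be the diagonal matrix of the weights and √W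 its entrywise square root. Then the matrix Y = √W Qᵀ V is diagonal with each diagonal entry equal to +1 or −1. -/
open Polynomial MeasureTheory Matrix

/-- An orthogonal matrix commuting with a diagonal matrix that has distinct diagonal entries is
diagonal with entries `±1`. -/
lemma isDiag_and_sign_of_orthogonal_of_commute {m : Type*} [Fintype m] [DecidableEq m]
    {x : m → ℝ} (hx : Function.Injective x) {Y : Matrix m m ℝ} (hY : Yᵀ * Y = 1)
    (hcomm : Matrix.diagonal x * Y = Y * Matrix.diagonal x) :
    Y.IsDiag ∧ ∀ i, Y i i = 1 ∨ Y i i = -1 := by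
  have hdiag : Y.IsDiag := by
    intro i j hij
    have h := congrFun (congrFun hcomm i) j
    rw [Matrix.diagonal_mul, Matrix.mul_diagonal] at h
    have h0 : (x i - x j) * Y i j = 0 := by linarith
    exact (mul_eq_zero.mp h0).resolve_left (sub_ne_zero.mpr (hx.ne hij))
  refine ⟨hdiag, fun i => ?_⟩
  have h := congrFun (congrFun hY i) i
  rw [Matrix.mul_apply, Matrix.one_apply_eq, Finset.sum_eq_single i] at h
  · exact mul_self_eq_one_iff.mp h
  · intro k _ hk
    rw [hdiag hk, mul_zero]
  · simp

/-- Entries of `Q * diagonal d * Qᵀ` as weighted sums. -/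
lemma mul_diagonal_mul_transpose_apply {m : Type*} [Fintype m] [DecidableEq m]
    (Q : Matrix m m ℝ) (d : m → ℝ) (i j : m) :
    (Q * Matrix.diagonal d * Qᵀ) i j = ∑ k, d k * (Q i k * Q j k) := by
  rw [Matrix.mul_apply]
  refine Finset.sum_congr rfl fun k _ => ?_
  rw [Matrix.mul_diagonal, Matrix.transpose_apply]
  ring

/-- If `Vᵀ B V = I`, `A V = B V D` with `D` diagonal and `D_{ii} = x_i`, then
`Y = √W Qᵀ V` is a diagonal matrix whose diagonal entries are all `±1`. -/
theorem sqrtW_Qt_V_is_diagonal_sign_matrix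
    (n : ℕ) (a b : ℝ) (hab : a < b)
    (w : ℝ → ℝ) (hw_cont : ContinuousOn w (Set.Icc a b))
    (hw_pos : ∀ t ∈ Set.Ioo a b, 0 < w t)
    (x wts : Fin (n + 1) → ℝ)
    (hx : Function.Injective x)
    (hwts : ∀ k, 0 < wts k)
    (hquad : ∀ p : Polynomial ℝ, p.natDegree ≤ 2 * n + 1 →
      (∫ t in a..b, w t * p.eval t) = ∑ k, wts k * p.eval (x k))
    (q : Fin (n + 1) → Polynomial ℝ)
    (hq_deg : ∀ i, (q i).natDegree ≤ n)
    (hq_indep : LinearIndependent ℝ q)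
    (B A V D Q : Matrix (Fin (n + 1)) (Fin (n + 1)) ℝ)
    (hB : ∀ i j, B i j = ∫ t in a..b, w t * (q i).eval t * (q j).eval t)
    (hA : ∀ i j, A i j = ∫ t in a..b, w t * t * (q i).eval t * (q j).eval t)
    (hQ : ∀ i k, Q i k = (q i).eval (x k))
    (hD : D.IsDiag)
    (hVBV : Vᵀ * B * V = 1)
    (hAV : A * V = B * V * D)
    (hDx : ∀ i, D i i = x i) :
    (Matrix.diagonal (fun k => Real.sqrt (wts k)) * Qᵀ * V).IsDiag ∧
      ∀ i, (Matrix.diagonal (fun k => Real.sqrt (wts k)) * Qᵀ * V) i i = 1 ∨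
        (Matrix.diagonal (fun k => Real.sqrt (wts k)) * Qᵀ * V) i i = -1 := by
  have hBQ : B = Q * Matrix.diagonal wts * Qᵀ := by
    ext i j
    have hdeg : (q i * q j).natDegree ≤ 2 * n + 1 := by
      have h := natDegree_mul_le (p := q i) (q := q j)
      have hi := hq_deg i
      have hj := hq_deg j
      omega
    rw [hB, mul_diagonal_mul_transpose_apply]
    simpa only [eval_mul, hQ, mul_assoc] using hquad _ hdeg
  have hAQ : A = Q * Matrix.diagonal (fun k => wts k * x k) * Qᵀ := by
    ext i j
    have hdeg : (X * (q i * q j)).natDegree ≤ 2 * n + 1 := by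
      have h := natDegree_mul_le (p := q i) (q := q j)
      have h' := natDegree_mul_le (p := (X : ℝ[X])) (q := q i * q j)
      rw [natDegree_X] at h'
      have hi := hq_deg i
      have hj := hq_deg j
      omega
    rw [hA, mul_diagonal_mul_transpose_apply]
    simpa only [eval_mul, eval_X, hQ, mul_assoc] using hquad _ hdeg
  have hDdiag : D = Matrix.diagonal x := by
    rw [← hD.diagonal_diag]
    exact congrArg Matrix.diagonal (funext hDx)
  set S := Matrix.diagonal (fun k => Real.sqrt (wts k)) with hS
  have hST : Sᵀ = S := Matrix.diagonal_transpose _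
  have hSS : S * S = Matrix.diagonal wts := by
    rw [hS, Matrix.diagonal_mul_diagonal]
    exact congrArg Matrix.diagonal (funext fun k => Real.mul_self_sqrt (hwts k).le)
  have hSXS : S * Matrix.diagonal x * S = Matrix.diagonal (fun k => wts k * x k) := by
    rw [hS, Matrix.diagonal_mul_diagonal, Matrix.diagonal_mul_diagonal]
    refine congrArg Matrix.diagonal (funext fun k => ?_)
    rw [mul_right_comm, Real.mul_self_sqrt (hwts k).le]
  have hYT : (S * Qᵀ * V)ᵀ = Vᵀ * Q * S := by
    simp only [Matrix.transpose_mul, Matrix.transpose_transpose, hST, Matrix.mul_assoc]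
  have hYY : (S * Qᵀ * V)ᵀ * (S * Qᵀ * V) = 1 := by
    rw [hYT, ← hVBV, hBQ, ← hSS]
    simp only [Matrix.mul_assoc]
  have hYXY : (S * Qᵀ * V)ᵀ * (Matrix.diagonal x * (S * Qᵀ * V)) = Matrix.diagonal x := by
    calc (S * Qᵀ * V)ᵀ * (Matrix.diagonal x * (S * Qᵀ * V))
        = Vᵀ * (A * V) := by
          rw [hYT, hAQ, ← hSXS]
          simp only [Matrix.mul_assoc]
      _ = Vᵀ * B * V * D := by
          rw [hAV]
          simp only [Matrix.mul_assoc]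
      _ = Matrix.diagonal x := by rw [hVBV, Matrix.one_mul, hDdiag]
  refine isDiag_and_sign_of_orthogonal_of_commute hx hYY ?_
  conv_rhs => rw [← hYXY]
  rw [← Matrix.mul_assoc (S * Qᵀ * V), mul_eq_one_comm.mp hYY, Matrix.one_mul]
end

section
/- (Theorem 3′: Gaussian quadrature on the unit circle) Suppose z_1,…,z_{n+1} are distinct nonzero complex numbers and w_1,…,w_{n+1} are nonzero complex numbers such that (1/2π) ∫_0^{2π} f(e^{iθ}) w(θ) dθ = Σ_{r=1}^{n+1} w_r f(z_r) for every Laurent polynomial f in the span of z^{-n},…,z^n,z^{n+1}. Let q_1,…,q_{n+1} be a basis of the space of complex polynomials of degree at most n, define B_{rs} = (1/2π) ∫_0^{2π} w(θ) conj(q_r(e^{iθ})) q_s(e^{iθ}) dθ and A_{rs} = (1/2π) ∫_0^{2π} w(θ) conj(q_r(e^{iθ})) e^{iθ} q_s(e^{iθ}) dθ, and suppose V is an invertible complex matrix and D a diagonal matrix with A V = B V D. Then, after a suitable reordering of the indexing of the pairs (z_r, w_r), z_r = D_{rr} for all r, and w_r · q_s(z_r) · conj(q_s(1/conj(z_r)))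 = (V^{-1})_{rs} (BV)_{sr} for all r and all s. -/
open Polynomial Matrix Complex Real

/-- Evaluating linearly independent polynomials of degree at most `n` at `n + 1` distinct points
gives an invertible matrix. -/
lemma isUnit_evalMatrix {K : Type*} [Field K] {n : ℕ} {q : Fin (n + 1) → K[X]}
    (hdeg : ∀ r, (q r).natDegree ≤ n) (hindep : LinearIndependent K q)
    {x : Fin (n + 1) → K} (hx : Function.Injective x) :
    IsUnit (Matrix.of fun r s => (q s).eval (x r)) := by
  rw [← Matrix.mulVec_injective_iff_isUnit, ← Matrix.coe_mulVecLin, ← LinearMap.ker_eq_bot,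
    LinearMap.ker_eq_bot']
  intro c hc
  have hroot : ∀ r, (∑ s, c s • q s).eval (x r) = 0 := by
    intro r
    have h := congrFun hc r
    simpa [Matrix.mulVec, dotProduct, Polynomial.eval_finsetSum, mul_comm] using h
  have hzero : ∑ s, c s • q s = 0 := by
    refine Polynomial.eq_zero_of_natDegree_lt_card_of_eval_eq_zero _ hx hroot ?_
    rw [Fintype.card_fin, Nat.lt_succ_iff]
    exact Polynomial.natDegree_sum_le_of_forall_le _ _
      fun s _ => (Polynomial.natDegree_smul_le _ _).trans (hdeg s)
  exact funext (Fintype.linearIndependent_iff.mp hindep c hzero)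

/-- A quadrature rule on the unit circle that is exact for `z ^ k`, `-n ≤ k ≤ n + 1`, computes the
weighted sesquilinear pairing of polynomials of degrees at most `n` and `n + 1`. -/
lemma circle_quadrature_pairing {n : ℕ} {ι : Type*} [Fintype ι] {w : ℝ → ℝ}
    (hw : Continuous w) {z wts : ι → ℂ} (hz : ∀ r, z r ≠ 0)
    (hquad : ∀ k : ℤ, -(n : ℤ) ≤ k → k ≤ (n : ℤ) + 1 →
      (1 / (2 * Real.pi) : ℂ) *
          ∫ θ in (0 : ℝ)..(2 * Real.pi), (w θ : ℂ) * Complex.exp (θ * Complex.I) ^ k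
        = ∑ r, wts r * z r ^ k)
    {p q : ℂ[X]} (hp : p.natDegree ≤ n) (hq : q.natDegree ≤ n + 1) :
    (1 / (2 * Real.pi) : ℂ) *
      ∫ θ in (0 : ℝ)..(2 * Real.pi),
        (w θ : ℂ) * starRingEnd ℂ (p.eval (Complex.exp (θ * Complex.I)))
          * q.eval (Complex.exp (θ * Complex.I))
      = ∑ r, starRingEnd ℂ (p.eval (1 / starRingEnd ℂ (z r))) * wts r * q.eval (z r) := by
  have expand : ∀ u : ℂ, u ≠ 0 →
      starRingEnd ℂ (p.eval (1 / starRingEnd ℂ u)) * q.eval u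
        = ∑ i ∈ Finset.range (n + 1), ∑ j ∈ Finset.range (n + 2),
          starRingEnd ℂ (p.coeff i) * q.coeff j * u ^ ((j : ℤ) - i) := by
    intro u hu
    rw [Polynomial.eval_eq_sum_range' (Nat.lt_succ_of_le hp),
      Polynomial.eval_eq_sum_range' (Nat.lt_succ_of_le hq), map_sum, Finset.sum_mul_sum]
    refine Finset.sum_congr rfl fun i _ => Finset.sum_congr rfl fun j _ => ?_
    rw [zpow_sub₀ hu, zpow_natCast, zpow_natCast]
    simp only [one_div, inv_pow, map_mul, map_inv₀, map_pow, Complex.conj_conj]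
    field_simp
  have hconj : ∀ θ : ℝ, 1 / starRingEnd ℂ (Complex.exp (θ * Complex.I))
      = Complex.exp (θ * Complex.I) := by
    intro θ
    rw [← Complex.exp_conj, one_div, ← Complex.exp_neg]
    simp
  have hint : ∀ (c : ℂ) (k : ℤ), IntervalIntegrable
      (fun θ : ℝ => c * ((w θ : ℂ) * Complex.exp (θ * Complex.I) ^ k))
      MeasureTheory.volume 0 (2 * Real.pi) := by
    intro c k
    refine Continuous.intervalIntegrable ?_ _ _
    have hexp : Continuous fun θ : ℝ => Complex.exp (θ * Complex.I) ^ k :=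
      Continuous.zpow₀ (by fun_prop) k fun θ => Or.inl (Complex.exp_ne_zero _)
    fun_prop
  have hintegrand : ∀ θ : ℝ,
      (w θ : ℂ) * starRingEnd ℂ (p.eval (Complex.exp (θ * Complex.I)))
          * q.eval (Complex.exp (θ * Complex.I))
        = ∑ i ∈ Finset.range (n + 1), ∑ j ∈ Finset.range (n + 2),
          starRingEnd ℂ (p.coeff i) * q.coeff j
            * ((w θ : ℂ) * Complex.exp (θ * Complex.I) ^ ((j : ℤ) - i)) := by
    intro θ
    have h := expand _ (Complex.exp_ne_zero (θ * Complex.I))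
    rw [hconj] at h
    rw [mul_assoc, h, Finset.mul_sum]
    simp only [Finset.mul_sum]
    refine Finset.sum_congr rfl fun i _ => Finset.sum_congr rfl fun j _ => ?_
    ring
  simp only [hintegrand]
  have hint_sum : ∀ i ∈ Finset.range (n + 1), IntervalIntegrable
      (fun θ : ℝ => ∑ j ∈ Finset.range (n + 2), starRingEnd ℂ (p.coeff i) * q.coeff j
        * ((w θ : ℂ) * Complex.exp (θ * Complex.I) ^ ((j : ℤ) - i)))
      MeasureTheory.volume 0 (2 * Real.pi) := by
    intro i _
    simpa only [Finset.sum_fn] using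
      IntervalIntegrable.sum (Finset.range (n + 2)) fun j _ =>
        hint (starRingEnd ℂ (p.coeff i) * q.coeff j) ((j : ℤ) - i)
  rw [intervalIntegral.integral_finsetSum hint_sum, Finset.mul_sum]
  have hnodes : ∀ r, starRingEnd ℂ (p.eval (1 / starRingEnd ℂ (z r))) * wts r * q.eval (z r)
      = ∑ i ∈ Finset.range (n + 1), ∑ j ∈ Finset.range (n + 2),
          starRingEnd ℂ (p.coeff i) * q.coeff j * (wts r * z r ^ ((j : ℤ) - i)) := by
    intro r
    rw [mul_right_comm, expand _ (hz r), Finset.sum_mul]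
    simp only [Finset.sum_mul]
    refine Finset.sum_congr rfl fun i _ => Finset.sum_congr rfl fun j _ => ?_
    ring
  simp only [hnodes]
  rw [Finset.sum_comm]
  refine Finset.sum_congr rfl fun i hi => ?_
  rw [intervalIntegral.integral_finsetSum fun j _ => hint _ _, Finset.mul_sum, Finset.sum_comm]
  refine Finset.sum_congr rfl fun j hj => ?_
  rw [Finset.mem_range] at hi hj
  rw [intervalIntegral.integral_const_mul, ← Finset.mul_sum,
    ← hquad _ (by omega) (by omega)]
  ring

/-- An invertible matrix has a nowhere vanishing generalized diagonal. -/
lemma exists_perm_forall_apply_ne_zero {m R : Type*} [Fintype m] [DecidableEq m] [CommRing R]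
    {U : Matrix m m R} (hU : U.det ≠ 0) : ∃ σ : Equiv.Perm m, ∀ r, U (σ r) r ≠ 0 := by
  rw [Matrix.det_apply] at hU
  obtain ⟨σ, -, hσ⟩ := Finset.exists_ne_zero_of_sum_ne_zero hU
  refine ⟨σ, fun r hr => hσ ?_⟩
  have hprod : ∏ i, U (σ i) i = 0 := Finset.prod_eq_zero (Finset.mem_univ r) hr
  rw [hprod, smul_zero]

/-- **Theorem 3′ (Gaussian quadrature on the unit circle).** If `V` is
invertible and `A V = B V D` with `D` diagonal, then (after a suitable
reordering of the pairs `(z_r, w_r)`) the nodes are the diagonal entries of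
`D`, and `w_r · q_s(z_r) · conj(q_s(1/conj(z_r))) = (V⁻¹)_{rs} (BV)_{sr}`
for every `s`. -/
theorem circle_nodes_and_weights
    (n : ℕ) (w : ℝ → ℝ) (hw_cont : Continuous w)
    (hw_per : Function.Periodic w (2 * Real.pi))
    (hw_nonneg : ∀ θ, 0 ≤ w θ)
    (z wts : Fin (n + 1) → ℂ)
    (hz_ne : ∀ r, z r ≠ 0)
    (hz_inj : Function.Injective z)
    (hwts : ∀ r, wts r ≠ 0)
    (hquad : ∀ k : ℤ, -(n : ℤ) ≤ k → k ≤ (n : ℤ) + 1 →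
      (1 / (2 * Real.pi) : ℂ) *
          ∫ θ in (0 : ℝ)..(2 * Real.pi),
            (w θ : ℂ) * Complex.exp (θ * Complex.I) ^ k
        = ∑ r, wts r * z r ^ k)
    (q : Fin (n + 1) → Polynomial ℂ)
    (hq_deg : ∀ r, (q r).natDegree ≤ n)
    (hq_indep : LinearIndependent ℂ q)
    (B A V D : Matrix (Fin (n + 1)) (Fin (n + 1)) ℂ)
    (hB : ∀ r s, B r s = (1 / (2 * Real.pi) : ℂ) *
      ∫ θ in (0 : ℝ)..(2 * Real.pi),
        (w θ : ℂ) * starRingEnd ℂ ((q r).eval (Complex.exp (θ * Complex.I)))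
          * (q s).eval (Complex.exp (θ * Complex.I)))
    (hA : ∀ r s, A r s = (1 / (2 * Real.pi) : ℂ) *
      ∫ θ in (0 : ℝ)..(2 * Real.pi),
        (w θ : ℂ) * starRingEnd ℂ ((q r).eval (Complex.exp (θ * Complex.I)))
          * Complex.exp (θ * Complex.I)
          * (q s).eval (Complex.exp (θ * Complex.I)))
    (hV : IsUnit V.det)
    (hD : D.IsDiag)
    (hAV : A * V = B * V * D) :
    ∃ σ : Equiv.Perm (Fin (n + 1)), ∀ r,
      z (σ r) = D r r ∧
      ∀ s, wts (σ r) * (q s).eval (z (σ r))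
          * starRingEnd ℂ ((q s).eval (1 / starRingEnd ℂ (z (σ r))))
        = V⁻¹ r s * (B * V) s r := by
  set Q : Matrix (Fin (n + 1)) (Fin (n + 1)) ℂ := Matrix.of fun r s => (q s).eval (z r) with hQ
  set P : Matrix (Fin (n + 1)) (Fin (n + 1)) ℂ :=
    (Matrix.of fun r s => (q s).eval (1 / starRingEnd ℂ (z r)))ᴴ with hP
  have hQ_unit : IsUnit Q := isUnit_evalMatrix hq_deg hq_indep hz_inj
  have hP_unit : IsUnit P := by
    have hinj : Function.Injective fun r => 1 / starRingEnd ℂ (z r) := fun r s hrs =>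
      hz_inj ((starRingEnd ℂ).injective (by simpa using hrs))
    exact (isUnit_evalMatrix hq_deg hq_indep hinj).star
  have hW_unit : IsUnit (Matrix.diagonal wts) := by
    rw [Matrix.isUnit_iff_isUnit_det, Matrix.det_diagonal, isUnit_iff_ne_zero]
    exact Finset.prod_ne_zero_iff.mpr fun r _ => hwts r
  have hB_eq : B = P * Matrix.diagonal wts * Q := by
    ext r s
    rw [hB, circle_quadrature_pairing hw_cont hz_ne hquad (hq_deg r) ((hq_deg s).trans n.le_succ),
      Matrix.mul_apply]
    simp [hP, hQ, Matrix.mul_diagonal]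
  have hA_eq : A = P * Matrix.diagonal wts * (Matrix.diagonal z * Q) := by
    ext r s
    have hdeg : (X * q s).natDegree ≤ n + 1 := by
      refine Polynomial.natDegree_mul_le.trans ?_
      rw [Polynomial.natDegree_X]
      have := hq_deg s
      omega
    have h := circle_quadrature_pairing hw_cont hz_ne hquad (hq_deg r) hdeg
    simp only [Polynomial.eval_mul, Polynomial.eval_X, ← mul_assoc] at h
    rw [hA, h, Matrix.mul_apply]
    simp [hP, hQ, Matrix.mul_diagonal, Matrix.diagonal_mul, mul_assoc]
  set U := Q * V with hU
  have hU_unit : IsUnit U := hQ_unit.mul ((Matrix.isUnit_iff_isUnit_det V).mpr hV)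
  have hU_det : IsUnit U.det := (Matrix.isUnit_iff_isUnit_det U).mp hU_unit
  have hZU : Matrix.diagonal z * U = U * D := by
    refine (hP_unit.mul hW_unit).mul_left_cancel ?_
    simpa only [hA_eq, hB_eq, hU, Matrix.mul_assoc] using hAV
  have hentry : ∀ r s, z r * U r s = U r s * D s s := by
    intro r s
    have h := congrFun (congrFun hZU r) s
    rwa [← hD.diagonal_diag, Matrix.diagonal_mul, Matrix.mul_diagonal, Matrix.diag_apply] at h
  obtain ⟨σ, hσ⟩ := exists_perm_forall_apply_ne_zero hU_det.ne_zero
  have hnode : ∀ r, z (σ r) = D r r := fun r =>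
    mul_right_cancel₀ (hσ r) ((hentry (σ r) r).trans (mul_comm _ _))
  have hoff : ∀ r t, t ≠ σ r → U t r = 0 := by
    intro r t ht
    by_contra hne
    have hzt : z t = D r r := mul_right_cancel₀ hne ((hentry t r).trans (mul_comm _ _))
    exact ht (hz_inj (hzt.trans (hnode r).symm))
  have hdiag : ∀ r, U⁻¹ r (σ r) * U (σ r) r = 1 := by
    intro r
    have h := congrFun (congrFun (Matrix.nonsing_inv_mul U hU_det) r) r
    rwa [Matrix.mul_apply, Finset.sum_eq_single (σ r)
      (fun t _ ht => by rw [hoff r t ht, mul_zero]) (by simp), Matrix.one_apply_eq] at h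
  have hinv_off : ∀ r t, t ≠ σ r → U⁻¹ r t = 0 := by
    intro r t ht
    obtain ⟨s, rfl⟩ := σ.surjective t
    have hrs : r ≠ s := fun h => ht (h ▸ rfl)
    have h := congrFun (congrFun (Matrix.nonsing_inv_mul U hU_det) r) s
    rw [Matrix.mul_apply, Finset.sum_eq_single (σ s)
      (fun t _ ht => by rw [hoff s t ht, mul_zero]) (by simp), Matrix.one_apply_ne hrs] at h
    exact (mul_eq_zero.mp h).resolve_right (hσ s)
  have hV_inv : V⁻¹ = U⁻¹ * Q := by
    refine Matrix.inv_eq_left_inv ?_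
    rw [Matrix.mul_assoc, ← hU, Matrix.nonsing_inv_mul U hU_det]
  have hBV : B * V = P * Matrix.diagonal wts * U := by
    rw [hB_eq, Matrix.mul_assoc, hU]
  refine ⟨σ, fun r => ⟨hnode r, fun s => ?_⟩⟩
  rw [hV_inv, hBV, Matrix.mul_apply, Matrix.mul_apply,
    Finset.sum_eq_single (σ r) (fun t _ ht => by rw [hinv_off r t ht, zero_mul]) (by simp),
    Finset.sum_eq_single (σ r) (fun t _ ht => by rw [hoff r t ht, mul_zero]) (by simp),
    Matrix.mul_diagonal]
  have hP_apply : P s (σ r) = starRingEnd ℂ ((q s).eval (1 / starRingEnd ℂ (z (σ r)))) := rfl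
  have hQ_apply : Q (σ r) s = (q s).eval (z (σ r)) := rfl
  rw [hP_apply, hQ_apply]
  linear_combination
    (-(wts (σ r) * (q s).eval (z (σ r))
      * starRingEnd ℂ ((q s).eval (1 / starRingEnd ℂ (z (σ r)))))) * hdiag r
end

section
/- (Theorem 3″: Gauss-type rules with fixed nodes) Let y_1,…,y_m ∈ [a,b] be given, and suppose x_1,…,x_{n+1} are distinct real numbers, distinct also from all the y_α, and w_1,…,w_{n+1}, v_1,…,v_m are nonzero real numbers such that ∫_a^b w(x) f(x) dx = Σ_{α=1}^m v_α f(y_α) + Σ_{i=1}^{n+1} w_i f(x_i) for every polynomial f of degree at most 2n+m+1. Let q_1,…,q_{n+1} be a basis of P_n, define B_{ij} = ∫_a^b w(x) ∏_{α=1}^m (x − y_α) q_i(x) q_j(x) dx and A_{ij} = ∫_a^b w(x) ∏_{α=1}^m (x − y_α) x q_i(x) q_j(x) dx, and suppose V is an invertible real matrix and D a diagonal matrix with A V = B V D. Then, after a suitable reordering of the indexing of the pairs (x_i, w_i), x_i = D_{ii} for all i, and w_i · ∏_{α=1}^m (x_i − y_α) · q_j(x_i)² = (V^{-1})_{ij}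 (BV)_{ji} for all i and all j. -/
open Polynomial Matrix MeasureTheory

/-- If `diagonal x * U = U * D` with `U` invertible, `x` injective and `D` diagonal, then `U` is
supported on the graph of a permutation `σ`, along which `x` and `D` agree. -/
theorem exists_perm_of_diagonal_mul_eq_mul {ι K : Type*} [Fintype ι] [DecidableEq ι] [Field K]
    {x : ι → K} (hx : Function.Injective x) {U D : Matrix ι ι K} (hU : IsUnit U.det)
    (hD : D.IsDiag) (h : diagonal x * U = U * D) :
    ∃ σ : Equiv.Perm ι, (∀ i, x (σ i) = D i i) ∧ ∀ k i, k ≠ σ i → U k i = 0 := by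
  have hnode : ∀ k i, U k i ≠ 0 → x k = D i i := by
    intro k i hki
    have h' := congrFun (congrFun h k) i
    rw [← hD.diagonal_diag, diagonal_mul, mul_diagonal, diag_apply, mul_comm] at h'
    exact mul_left_cancel₀ hki h'
  have hcol : ∀ i, ∃ k, U k i ≠ 0 := by
    intro i
    by_contra! hc
    exact hU.ne_zero (det_eq_zero_of_column_eq_zero i hc)
  choose σ hσ using hcol
  have hsupp : ∀ k i, U k i ≠ 0 → k = σ i := fun k i hki =>
    hx ((hnode k i hki).trans (hnode (σ i) i (hσ i)).symm)
  have hsurj : Function.Surjective σ := by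
    intro k
    by_contra! hc
    refine hU.ne_zero (det_eq_zero_of_row_eq_zero k fun i => ?_)
    by_contra hki
    exact hc i (hsupp k i hki).symm
  refine ⟨Equiv.ofBijective σ (Finite.injective_iff_bijective.1
    (Finite.injective_iff_surjective.2 hsurj)), fun i => hnode _ _ (hσ i), fun k i hki => ?_⟩
  by_contra hne
  exact hki (hsupp k i hne)

/-- The evaluation matrix of linearly independent polynomials of degree at most `n` at `n + 1`
distinct points is invertible. -/
theorem isUnit_det_of_eval_of_linearIndependent {K : Type*} [Field K] {n : ℕ}
    {x : Fin (n + 1) → K} (hx : Function.Injective x) {q : Fin (n + 1) → K[X]}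
    (hdeg : ∀ i, (q i).natDegree ≤ n) (hq : LinearIndependent K q) :
    IsUnit (Matrix.of fun i j => (q j).eval (x i)).det := by
  rw [isUnit_iff_ne_zero]
  intro hdet
  obtain ⟨z, hz, hQz⟩ := exists_mulVec_eq_zero_iff.2 hdet
  have hsum : ∑ j, z j • q j = 0 := by
    refine eq_zero_of_natDegree_lt_card_of_eval_eq_zero _ hx (fun i => ?_) ?_
    · have h := congrFun hQz i
      simp only [mulVec, dotProduct, of_apply, Pi.zero_apply] at h
      simpa [eval_finsetSum, mul_comm] using h
    · rw [Fintype.card_fin, Nat.lt_succ_iff]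
      exact natDegree_sum_le_of_forall_le _ _
        fun j _ => (natDegree_smul_le _ _).trans (hdeg j)
  exact hz (funext (Fintype.linearIndependent_iff.1 hq z hsum))

/-- If a quadrature rule is exact up to degree `N`, then integrating the multiple of `g` by the
nodal polynomial of the fixed nodes `y` involves only the free nodes `x`. -/
theorem integral_mul_nodal_eq_sum {m N : ℕ} {ι : Type*} [Fintype ι] {a b : ℝ} {w : ℝ → ℝ}
    {y v : Fin m → ℝ} {x c : ι → ℝ}
    (hquad : ∀ f : ℝ[X], f.natDegree ≤ N →
      (∫ t in a..b, w t * f.eval t) = ∑ α, v α * f.eval (y α) + ∑ i, c i * f.eval (x i))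
    (g : ℝ[X]) (hg : g.natDegree + m ≤ N) :
    (∫ t in a..b, w t * ((∏ α, (t - y α)) * g.eval t))
      = ∑ i, c i * (∏ α, (x i - y α)) * g.eval (x i) := by
  have heval : ∀ t, ((∏ α, (X - C (y α))) * g).eval t = (∏ α, (t - y α)) * g.eval t := by
    intro t
    simp [eval_prod]
  have hdeg : ((∏ α, (X - C (y α))) * g).natDegree ≤ N := by
    refine natDegree_mul_le.trans ?_
    have : (∏ α, (X - C (y α))).natDegree = m := by
      simp
    lia
  have h := hquad _ hdeg
  simp only [heval] at h
  have hzero : ∀ α, ∏ β, (y α - y β) = 0 := fun α =>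
    Finset.prod_eq_zero (Finset.mem_univ α) (sub_self _)
  simpa [hzero, mul_assoc] using h

/-- **Theorem 3″ (Gauss-type rules with fixed nodes).** If `V` is invertible
and `A V = B V D` with `D` diagonal, then (after a suitable reordering of the
pairs `(x_i, w_i)`) the free nodes are the diagonal entries of `D`, and
`w_i · ∏_α (x_i − y_α) · q_j(x_i)² = (V⁻¹)_{ij} (BV)_{ji}` for every `j`. -/
theorem gauss_type_fixed_nodes
(n m : ℕ) (a b : ℝ) (hab : a < b)
    (w : ℝ → ℝ) (hw_cont : ContinuousOn w (Set.Icc a b))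
    (y : Fin m → ℝ) (hy : ∀ α, y α ∈ Set.Icc a b)
    (x wts : Fin (n + 1) → ℝ) (v : Fin m → ℝ)
    (hx_inj : Function.Injective x)
    (hxy : ∀ i α, x i ≠ y α)
    (hwts : ∀ i, wts i ≠ 0)
    (hv : ∀ α, v α ≠ 0)
    (hquad : ∀ f : Polynomial ℝ, f.natDegree ≤ 2 * n + m + 1 →
      (∫ t in a..b, w t * f.eval t)
        = ∑ α, v α * f.eval (y α) + ∑ i, wts i * f.eval (x i))
    (q : Fin (n + 1) → Polynomial ℝ)
    (hq_deg : ∀ i, (q i).natDegree ≤ n)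
    (hq_indep : LinearIndependent ℝ q)
    (B A V D : Matrix (Fin (n + 1)) (Fin (n + 1)) ℝ)
    (hB : ∀ i j, B i j = ∫ t in a..b,
      w t * (∏ α, (t - y α)) * (q i).eval t * (q j).eval t)
    (hA : ∀ i j, A i j = ∫ t in a..b,
      w t * (∏ α, (t - y α)) * t * (q i).eval t * (q j).eval t)
    (hV : IsUnit V.det)
    (hD : D.IsDiag)
    (hAV : A * V = B * V * D) :
    ∃ σ : Equiv.Perm (Fin (n + 1)), ∀ i,
      x (σ i) = D i i ∧
      ∀ j, wts (σ i) * (∏ α, (x (σ i) - y α)) * ((q j).eval (x (σ i))) ^ 2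
        = V⁻¹ i j * (B * V) j i := by
  set Q : Matrix (Fin (n + 1)) (Fin (n + 1)) ℝ := Matrix.of fun i j => (q j).eval (x i) with hQ
  set c : Fin (n + 1) → ℝ := fun i => wts i * ∏ α, (x i - y α) with hc
  have hQdet : IsUnit Q.det := isUnit_det_of_eval_of_linearIndependent hx_inj hq_deg hq_indep
  have hc0 : ∀ i, c i ≠ 0 := fun i =>
    mul_ne_zero (hwts i) (Finset.prod_ne_zero_iff.2 fun α _ => sub_ne_zero.2 (hxy i α))
  have hqq : ∀ i j, (q i * q j).natDegree ≤ 2 * n := fun i j =>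
    natDegree_mul_le.trans (by have := hq_deg i; have := hq_deg j; lia)
  have hBQ : B = Qᵀ * (diagonal c * Q) := by
    ext i j
    have h := integral_mul_nodal_eq_sum hquad (q i * q j) (by have := hqq i j; lia)
    simp only [eval_mul] at h
    rw [hB, mul_apply]
    simp only [transpose_apply, diagonal_mul, hQ, hc, of_apply]
    convert h using 2
    · ext t; ring
    · ring
  have hAQ : A = Qᵀ * (diagonal c * (diagonal x * Q)) := by
    ext i j
    have h := integral_mul_nodal_eq_sum hquad (X * (q i * q j))
      (by have := hqq i j; have := natDegree_mul_le (p := (X : ℝ[X])) (q := q i * q j)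
          rw [natDegree_X] at this; lia)
    simp only [eval_mul, eval_X] at h
    rw [hA, mul_apply]
    simp only [transpose_apply, diagonal_mul, hQ, hc, of_apply]
    convert h using 2
    · ext t; ring
    · ring
  have hcdet : IsUnit (diagonal c).det := by
    rw [det_diagonal, isUnit_iff_ne_zero]
    exact Finset.prod_ne_zero_iff.2 fun i _ => hc0 i
  have hcomm : diagonal x * (Q * V) = Q * V * D := by
    have hQt : IsUnit Qᵀ.det := by rwa [det_transpose]
    rw [hAQ, hBQ] at hAV
    simp only [Matrix.mul_assoc] at hAV ⊢
    have h₁ := congrArg (Qᵀ⁻¹ * ·) hAV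
    simp only [nonsing_inv_mul_cancel_left _ _ hQt] at h₁
    have h₂ := congrArg ((diagonal c)⁻¹ * ·) h₁
    simpa only [nonsing_inv_mul_cancel_left _ _ hcdet] using h₂
  obtain ⟨σ, hσ, hsupp⟩ := exists_perm_of_diagonal_mul_eq_mul hx_inj
    (by rw [det_mul]; exact hQdet.mul hV) hD hcomm
  refine ⟨σ, fun i => ⟨hσ i, fun j => ?_⟩⟩
  have hQrow : Q (σ i) j = (Q * V) (σ i) i * V⁻¹ i j := by
    conv_lhs => rw [← mul_nonsing_inv_cancel_right V Q hV, mul_apply]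
    refine Finset.sum_eq_single i (fun l _ hl => ?_) (by simp)
    rw [hsupp _ _ (σ.injective.ne hl.symm), zero_mul]
  have hBV : (B * V) j i = Q (σ i) j * (c (σ i) * (Q * V) (σ i) i) := by
    rw [hBQ, Matrix.mul_assoc, Matrix.mul_assoc, mul_apply]
    simp only [transpose_apply, diagonal_mul]
    refine Finset.sum_eq_single (σ i) (fun k _ hk => ?_) (by simp)
    rw [hsupp _ _ hk, mul_zero, mul_zero]
  change c (σ i) * Q (σ i) j ^ 2 = _
  rw [hBV]
  linear_combination c (σ i) * Q (σ i) j * hQrow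
end

section
/- Suppose y_1,…,y_m ∈ [a,b], x_1,…,x_{n+1} are distinct real numbers distinct also from all the y_α, and w_1,…,w_{n+1}, v_1,…,v_m are nonzero real numbers such that ∫_a^b w(x) f(x) dx = Σ_{α=1}^m v_α f(y_α) + Σ_{i=1}^{n+1} w_i f(x_i) for every polynomial f of degree at most 2n+m+1. Let q_1,…,q_{n+1} be a basis of P_n, define B_{ij} = ∫_a^b w(x) ∏_{α=1}^m (x − y_α) q_i(x) q_j(x) dx and A_{ij} = ∫_a^b w(x) ∏_{α=1}^m (x − y_α) x q_i(x) q_j(x) dx, let Q_{ik} = q_i(x_k), and let X and W' be the diagonal matrices with diagonal entries x_k and w_k ∏_{α=1}^m (x_k − y_α) respectively. Then B = Q W' Qᵀ and A = Q W' X Qᵀ. -/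
open Polynomial Matrix MeasureTheory

/-- A quadrature rule exact in degree `d + m`, multiplied by the nodal polynomial of its `m` fixed
nodes, no longer sees the fixed nodes and is exact in degree `d`. -/
theorem integral_mul_prod_sub_mul_eval_eq_sum {ι : Type*} [Fintype ι] {m d : ℕ} {a b : ℝ}
    {w : ℝ → ℝ} {y v : Fin m → ℝ} {x wts : ι → ℝ}
    (hquad : ∀ f : Polynomial ℝ, f.natDegree ≤ d + m →
      (∫ t in a..b, w t * f.eval t)
        = ∑ α, v α * f.eval (y α) + ∑ i, wts i * f.eval (x i))
    {g : Polynomial ℝ} (hg : g.natDegree ≤ d) :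
    (∫ t in a..b, w t * ((∏ α, (t - y α)) * g.eval t))
      = ∑ i, wts i * ((∏ α, (x i - y α)) * g.eval (x i)) := by
  have hdeg : ((∏ α, (X - C (y α))) * g).natDegree ≤ d + m := by
    refine natDegree_mul_le.trans ?_
    rw [natDegree_finsetProd_X_sub_C_eq_card]
    simp only [Finset.card_univ, Fintype.card_fin]
    lia
  have hnode : ∀ α, ∏ β, (y α - y β) = 0 := fun α =>
    Finset.prod_eq_zero (Finset.mem_univ α) (sub_self _)
  simpa [eval_prod, hnode] using hquad _ hdeg

/-- For Gauss-type rules with fixed nodes `y_α`, the Gram-type matrices built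
with the modified weight `w(x)·∏_α (x − y_α)` factor as `B = Q W' Qᵀ` and
`A = Q W' X Qᵀ`, where `Q_{ik} = q_i(x_k)` and `W'` is the diagonal matrix
with entries `w_k ∏_α (x_k − y_α)`. -/
theorem gauss_type_fixed_nodes_factorization
(n m : ℕ) (a b : ℝ) (hab : a < b)
    (w : ℝ → ℝ) (hw_cont : ContinuousOn w (Set.Icc a b))
    (y : Fin m → ℝ) (hy : ∀ α, y α ∈ Set.Icc a b)
    (x wts : Fin (n + 1) → ℝ) (v : Fin m → ℝ)
    (hx_inj : Function.Injective x)
    (hxy : ∀ i α, x i ≠ y α)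
    (hwts : ∀ i, wts i ≠ 0)
    (hv : ∀ α, v α ≠ 0)
    (hquad : ∀ f : Polynomial ℝ, f.natDegree ≤ 2 * n + m + 1 →
      (∫ t in a..b, w t * f.eval t)
        = ∑ α, v α * f.eval (y α) + ∑ i, wts i * f.eval (x i))
    (q : Fin (n + 1) → Polynomial ℝ)
    (hq_deg : ∀ i, (q i).natDegree ≤ n)
    (hq_indep : LinearIndependent ℝ q)
    (B A Q : Matrix (Fin (n + 1)) (Fin (n + 1)) ℝ)
    (hB : ∀ i j, B i j = ∫ t in a..b,
      w t * (∏ α, (t - y α)) * (q i).eval t * (q j).eval t)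
    (hA : ∀ i j, A i j = ∫ t in a..b,
      w t * (∏ α, (t - y α)) * t * (q i).eval t * (q j).eval t)
    (hQ : ∀ i k, Q i k = (q i).eval (x k)) :
    B = Q * Matrix.diagonal (fun k => wts k * ∏ α, (x k - y α)) * Qᵀ ∧
      A = Q * Matrix.diagonal (fun k => wts k * ∏ α, (x k - y α))
            * Matrix.diagonal x * Qᵀ := by
  have hquad' : ∀ f : Polynomial ℝ, f.natDegree ≤ (2 * n + 1) + m →
      (∫ t in a..b, w t * f.eval t)
        = ∑ α, v α * f.eval (y α) + ∑ i, wts i * f.eval (x i) :=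
    fun f hf => hquad f (by lia)
  have hmul : ∀ i j, (q i * q j).natDegree ≤ 2 * n := fun i j =>
    natDegree_mul_le.trans (by linarith [hq_deg i, hq_deg j])
  constructor
  · ext i j
    have h := integral_mul_prod_sub_mul_eval_eq_sum hquad' ((hmul i j).trans (Nat.le_succ _))
    rw [hB, Matrix.mul_apply]
    simp only [Matrix.mul_diagonal, Matrix.transpose_apply, hQ]
    simp only [eval_mul] at h
    convert h using 2
    · ext t
      ring
    · ring
  · ext i j
    have hdeg : (X * (q i * q j)).natDegree ≤ 2 * n + 1 :=
      natDegree_mul_le.trans (by rw [natDegree_X]; linarith [hmul i j])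
    have h := integral_mul_prod_sub_mul_eval_eq_sum hquad' hdeg
    rw [hA, Matrix.mul_apply]
    simp only [Matrix.mul_diagonal, Matrix.transpose_apply, hQ]
    simp only [eval_mul, eval_X] at h
    convert h using 2
    · ext t
      ring
    · ring
end
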